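/- Let 0 < r < R₀ and let A(R₀, r) = {z ∈ ℝ² : r < |z| < R₀}. Let v : ℝ² → ℝ² be continuously differentiable on a neighborhood of the closed annulus {z : r ≤ |z| ≤ R₀} with v(z) = 0 whenever |z| = R₀, let A be a real 2×2 matrix, and set w(z) = v(z) + Az. Then r ∫₀^{2π} |w(r σ(θ))|² dθ ≤ r · log(R₀/r) · ∫_{A(R₀,r)} ‖Dv(z) − (r/(R₀ − r)) A‖² dz. -/

import Mathlib

open Real MeasureTheory Set Metric

noncomputable section

/-- The point on the unit circle at angle `θ`, as an element of the Euclidean plane. -/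
def sig (θ : ℝ) : EuclideanSpace ℝ (Fin 2) :=
  (EuclideanSpace.equiv (Fin 2) ℝ).symm ![Real.cos θ, Real.sin θ]

/-- First standard basis vector of the Euclidean plane. -/
def e₀ : EuclideanSpace ℝ (Fin 2) := EuclideanSpace.single 0 1

/-- Second standard basis vector of the Euclidean plane. -/
def e₁ : EuclideanSpace ℝ (Fin 2) := EuclideanSpace.single 1 1

/-- The squared Frobenius norm of a linear map of the Euclidean plane
(= sum of the squared Euclidean norms of its columns). -/
def frobSq (L : EuclideanSpace ℝ (Fin 2) →L[ℝ] EuclideanSpace ℝ (Fin 2)) : ℝ :=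
  ‖L e₀‖ ^ 2 + ‖L e₁‖ ^ 2

lemma norm_sig (θ : ℝ) : ‖sig θ‖ = 1 := by
  simp [sig, EuclideanSpace.norm_eq, Fin.sum_univ_two]

lemma sig_eq (θ : ℝ) : sig θ = Real.cos θ • e₀ + Real.sin θ • e₁ := by
  ext i
  fin_cases i <;> simp [sig, e₀, e₁]

lemma continuous_sig : Continuous sig := by
  have h : sig = fun θ ↦ Real.cos θ • e₀ + Real.sin θ • e₁ := funext sig_eq
  rw [h]
  fun_prop

lemma sig_add_two_pi (θ : ℝ) : sig (θ + 2 * π) = sig θ := by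
  simp [sig]

lemma norm_smul_sig {s : ℝ} (hs : 0 ≤ s) (θ : ℝ) : ‖s • sig θ‖ = s := by
  rw [norm_smul, norm_sig, mul_one, Real.norm_of_nonneg hs]

lemma repr_polarCoord_symm (p : ℝ × ℝ) :
    Complex.orthonormalBasisOneI.repr (Complex.polarCoord.symm p) = p.1 • sig p.2 := by
  ext i
  fin_cases i <;>
    simp [Complex.orthonormalBasisOneI_repr_apply, Complex.polarCoord_symm_apply, sig,
      -Complex.ofReal_cos, -Complex.ofReal_sin]

lemma norm_map_sig_sq_le_frobSq
    (L : EuclideanSpace ℝ (Fin 2) →L[ℝ] EuclideanSpace ℝ (Fin 2)) (θ : ℝ) :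
    ‖L (sig θ)‖ ^ 2 ≤ frobSq L := by
  have h : ‖L (sig θ)‖ ≤ |Real.cos θ| * ‖L e₀‖ + |Real.sin θ| * ‖L e₁‖ := by
    rw [sig_eq, map_add, map_smul, map_smul]
    exact (norm_add_le _ _).trans_eq (by simp [norm_smul])
  have hcs : |Real.cos θ| ^ 2 + |Real.sin θ| ^ 2 = 1 := by simp
  calc ‖L (sig θ)‖ ^ 2 ≤ (|Real.cos θ| * ‖L e₀‖ + |Real.sin θ| * ‖L e₁‖) ^ 2 := by gcongr
    _ ≤ (|Real.cos θ| ^ 2 + |Real.sin θ| ^ 2) * frobSq L := by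
      unfold frobSq
      nlinarith [sq_nonneg (|Real.cos θ| * ‖L e₁‖ - |Real.sin θ| * ‖L e₀‖)]
    _ = frobSq L := by rw [hcs, one_mul]

/-- Integration over an annulus in polar coordinates. -/
lemma integral_annulus_eq_polar {r R : ℝ} (hr : 0 < r)
    (G : EuclideanSpace ℝ (Fin 2) → ℝ) :
    ∫ z in {z : EuclideanSpace ℝ (Fin 2) | r < ‖z‖ ∧ ‖z‖ < R}, G z =
      ∫ p in Ioo r R ×ˢ Ioo (-π) π, p.1 * G (p.1 • sig p.2) := by
  set S := {z : EuclideanSpace ℝ (Fin 2) | r < ‖z‖ ∧ ‖z‖ < R}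
  have hS : MeasurableSet S :=
    (measurableSet_lt measurable_const measurable_norm).inter
      (measurableSet_lt measurable_norm measurable_const)
  have hT : MeasurableSet (Ioo r R ×ˢ Ioo (-π) π) := measurableSet_Ioo.prod measurableSet_Ioo
  have hsub : Ioo r R ×ˢ Ioo (-π) π ⊆ polarCoord.target := by
    rw [polarCoord_target]
    exact prod_mono (fun s hs ↦ hr.trans hs.1) subset_rfl
  rw [← integral_indicator hS,
    ← Complex.orthonormalBasisOneI.measurePreserving_repr.integral_comp
      Complex.orthonormalBasisOneI.repr.toHomeomorph.measurableEmbedding,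
    ← Complex.integral_comp_polarCoord_symm,
    setIntegral_eq_of_subset_of_forall_sdiff_eq_zero
      polarCoord.open_target.measurableSet hsub ?_]
  · refine setIntegral_congr_fun hT fun p hp ↦ ?_
    have hp0 : 0 ≤ p.1 := (hr.trans hp.1.1).le
    have hmem : p.1 • sig p.2 ∈ S := by
      simpa only [S, mem_ofPred_eq, norm_smul_sig hp0, mem_Ioo] using hp.1
    simp only [repr_polarCoord_symm, indicator_of_mem hmem, smul_eq_mul]
  · rintro p ⟨hp, hpn⟩
    rw [polarCoord_target] at hp
    have hmem : p.1 • sig p.2 ∉ S := by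
      simp only [S, mem_ofPred_eq, norm_smul_sig (le_of_lt hp.1)]
      exact fun h ↦ hpn ⟨h, hp.2⟩
    simp only [repr_polarCoord_symm, indicator_of_notMem hmem, smul_zero]

/-- The weighted Cauchy–Schwarz inequality with weight `s`. -/
lemma sq_integral_le_log_mul_integral {r R : ℝ} (hr : 0 < r) (hrR : r < R) {g : ℝ → ℝ}
    (hg : ContinuousOn g (Icc r R)) :
    (∫ s in r..R, g s) ^ 2 ≤ Real.log (R / r) * ∫ s in r..R, s * g s ^ 2 := by
  have hL : 0 < Real.log (R / r) := Real.log_pos ((one_lt_div hr).2 hrR)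
  set L := Real.log (R / r)
  set I := ∫ s in r..R, g s
  have hgi : IntervalIntegrable g volume r R := hg.intervalIntegrable_of_Icc hrR.le
  have hinv : IntervalIntegrable (fun s : ℝ ↦ 1 / s) volume r R :=
    ContinuousOn.intervalIntegrable_of_Icc hrR.le
      (continuousOn_const.div continuousOn_id fun s hs ↦ (hr.trans_le hs.1).ne')
  have hsq : IntervalIntegrable (fun s ↦ s * g s ^ 2) volume r R :=
    ContinuousOn.intervalIntegrable_of_Icc hrR.le (continuousOn_id.mul (hg.pow 2))
  have key : ∫ s in r..R, (2 * (I / L) * g s - (I / L) ^ 2 * (1 / s)) ≤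
      ∫ s in r..R, s * g s ^ 2 := by
    refine intervalIntegral.integral_mono_on hrR.le ((hgi.const_mul _).sub (hinv.const_mul _))
      hsq fun s hs ↦ ?_
    have hs0 : 0 < s := hr.trans_le hs.1
    have h : s * g s ^ 2 - (2 * (I / L) * g s - (I / L) ^ 2 * (1 / s)) =
        s * (g s - I / L / s) ^ 2 := by
      field_simp
      ring
    have : 0 ≤ s * (g s - I / L / s) ^ 2 := by positivity
    linarith
  rw [intervalIntegral.integral_sub (hgi.const_mul _) (hinv.const_mul _),
    intervalIntegral.integral_const_mul, intervalIntegral.integral_const_mul,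
    integral_one_div_of_pos hr (hr.trans hrR)] at key
  calc I ^ 2 = L * (2 * (I / L) * I - (I / L) ^ 2 * L) := by
        field_simp
        ring
    _ ≤ _ := by gcongr

theorem stmt5 (r R₀ : ℝ) (hr : 0 < r) (hrR : r < R₀)
    (v : EuclideanSpace ℝ (Fin 2) → EuclideanSpace ℝ (Fin 2))
    (U : Set (EuclideanSpace ℝ (Fin 2))) (hU : IsOpen U)
    (hUsub : {z : EuclideanSpace ℝ (Fin 2) | r ≤ ‖z‖ ∧ ‖z‖ ≤ R₀} ⊆ U)
    (hv : ContDiffOn ℝ 1 v U)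
    (hv0 : ∀ z : EuclideanSpace ℝ (Fin 2), ‖z‖ = R₀ → v z = 0)
    (A : EuclideanSpace ℝ (Fin 2) →L[ℝ] EuclideanSpace ℝ (Fin 2))
    (w : EuclideanSpace ℝ (Fin 2) → EuclideanSpace ℝ (Fin 2))
    (hw : ∀ z, w z = v z + A z) :
    r * ∫ θ in (0:ℝ)..(2 * Real.pi), ‖w (r • sig θ)‖ ^ 2 ≤
      r * Real.log (R₀ / r) *
        ∫ z in {z : EuclideanSpace ℝ (Fin 2) | r < ‖z‖ ∧ ‖z‖ < R₀},
          frobSq (fderiv ℝ v z - (r / (R₀ - r)) • A) := by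
  have hR : 0 < R₀ := hr.trans hrR
  have hπ : -π ≤ π := by linarith [Real.pi_pos]
  have hd : R₀ - r ≠ 0 := (sub_pos.2 hrR).ne'
  set c := r / (R₀ - r) with hc
  set M := fun z ↦ fderiv ℝ v z - c • A
  have hMcont : ContinuousOn M U :=
    (hv.continuousOn_fderiv_of_isOpen hU le_rfl).sub continuousOn_const
  have hmemU : ∀ s ∈ Icc r R₀, ∀ θ, s • sig θ ∈ U := fun s hs θ ↦
    hUsub (by simpa only [mem_ofPred_eq, norm_smul_sig (hr.le.trans hs.1), mem_Icc] using hs)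
  have hradial : ∀ θ, ContinuousOn (fun s : ℝ ↦ M (s • sig θ)) (Icc r R₀) := fun θ ↦
    hMcont.comp (by fun_prop) fun s hs ↦ hmemU s hs θ
  have hfrob : Continuous frobSq := by
    unfold frobSq
    fun_prop
  set F : ℝ × ℝ → ℝ := fun p ↦ p.1 * frobSq (M (p.1 • sig p.2))
  have hFcont : ContinuousOn F (Icc r R₀ ×ˢ Icc (-π) π) := by
    have hs : Continuous fun p : ℝ × ℝ ↦ p.1 • sig p.2 :=
      continuous_fst.smul (continuous_sig.comp continuous_snd)
    exact continuousOn_fst.mul (hfrob.comp_continuousOn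
      (hMcont.comp hs.continuousOn fun p hp ↦ hmemU p.1 hp.1 p.2))
  have hFint : Integrable F ((volume.restrict (Ioo r R₀)).prod (volume.restrict (Ioo (-π) π))) := by
    rw [Measure.prod_restrict]
    exact (hFcont.integrableOn_compact (isCompact_Icc.prod isCompact_Icc)).mono_set
      (prod_mono Ioo_subset_Icc_self Ioo_subset_Icc_self)
  have hray : ∀ θ, ‖w (r • sig θ)‖ ^ 2 ≤ Real.log (R₀ / r) * ∫ s in Ioo r R₀, F (s, θ) := by
    intro θ
    have hMsig : ContinuousOn (fun s : ℝ ↦ M (s • sig θ) (sig θ)) (Icc r R₀) :=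
      (hradial θ).clm_apply continuousOn_const
    have hftc : ∫ s in r..R₀, M (s • sig θ) (sig θ) = -w (r • sig θ) := by
      rw [intervalIntegral.integral_eq_sub_of_hasDerivAt
        (f := fun s ↦ v (s • sig θ) - c • A (s • sig θ)) ?_
        (hMsig.intervalIntegrable_of_Icc hrR.le)]
      · rw [hv0 _ (norm_smul_sig hR.le θ), hw]
        simp only [map_smul, smul_smul]
        have h : c * R₀ = c * r + r := by
          rw [hc]
          field_simp
          ring
        rw [h]
        module
      · intro s hs
        rw [uIcc_of_le hrR.le] at hs
        have hl : HasDerivAt (fun s : ℝ ↦ s • sig θ) (sig θ) s := by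
          simpa using (hasDerivAt_id s).smul_const (sig θ)
        have hvd : HasFDerivAt v (fderiv ℝ v (s • sig θ)) (s • sig θ) :=
          ((hv.contDiffAt (hU.mem_nhds (hmemU s hs θ))).differentiableAt one_ne_zero).hasFDerivAt
        exact (hvd.comp_hasDerivAt s hl).sub ((A.hasFDerivAt.comp_hasDerivAt s hl).const_smul c)
    calc ‖w (r • sig θ)‖ ^ 2 = ‖∫ s in r..R₀, M (s • sig θ) (sig θ)‖ ^ 2 := by
          rw [hftc, norm_neg]
      _ ≤ (∫ s in r..R₀, ‖M (s • sig θ) (sig θ)‖) ^ 2 := by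
          gcongr
          exact intervalIntegral.norm_integral_le_integral_norm hrR.le
      _ ≤ Real.log (R₀ / r) * ∫ s in r..R₀, s * ‖M (s • sig θ) (sig θ)‖ ^ 2 :=
          sq_integral_le_log_mul_integral hr hrR hMsig.norm
      _ ≤ Real.log (R₀ / r) * ∫ s in r..R₀, F (s, θ) := by
          have hlog : 0 ≤ Real.log (R₀ / r) := Real.log_nonneg ((one_le_div hr).2 hrR.le)
          refine mul_le_mul_of_nonneg_left (intervalIntegral.integral_mono_on hrR.le
            (ContinuousOn.intervalIntegrable_of_Icc hrR.le (continuousOn_id.mul (hMsig.norm.pow 2)))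
            (ContinuousOn.intervalIntegrable_of_Icc hrR.le
              (continuousOn_id.mul (hfrob.comp_continuousOn (hradial θ)))) fun s hs ↦ ?_) hlog
          exact mul_le_mul_of_nonneg_left (norm_map_sig_sq_le_frobSq _ θ) (hr.le.trans hs.1)
      _ = Real.log (R₀ / r) * ∫ s in Ioo r R₀, F (s, θ) := by
          rw [intervalIntegral.integral_of_le hrR.le, integral_Ioc_eq_integral_Ioo]
  have hwcont : Continuous fun θ ↦ ‖w (r • sig θ)‖ ^ 2 := by
    have h : Continuous fun θ ↦ v (r • sig θ) :=
      hv.continuousOn.comp_continuous (continuous_sig.const_smul r)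
        fun θ ↦ hmemU r (left_mem_Icc.2 hrR.le) θ
    simp only [hw]
    exact ((h.add (A.continuous.comp (continuous_sig.const_smul r))).norm).pow 2
  have hper : Function.Periodic (fun θ ↦ ‖w (r • sig θ)‖ ^ 2) (2 * π) := fun θ ↦ by
    simp only [sig_add_two_pi]
  have hshift := hper.intervalIntegral_add_eq 0 (-π)
  rw [zero_add, show -π + 2 * π = π by ring] at hshift
  rw [mul_assoc]
  refine mul_le_mul_of_nonneg_left ?_ hr.le
  rw [hshift, integral_annulus_eq_polar hr, Measure.volume_eq_prod, ← Measure.prod_restrict,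
    integral_prod_symm _ hFint, ← integral_const_mul, intervalIntegral.integral_of_le hπ,
    integral_Ioc_eq_integral_Ioo]
  exact integral_mono
    ((hwcont.continuousOn.integrableOn_compact isCompact_Icc).mono_set Ioo_subset_Icc_self)
    (hFint.integral_prod_right.const_mul _) hray

end
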